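/- Let p ∈ (2/3, 1) and let X be a random walk in the homogeneous 'have your cookie and eat it' environment ω ≡ p with X_0 = 1 almost surely. Then P(T_0 = ∞) ≥ (3p − 2)/(2p − 1); moreover, if p ∈ [3/4, 1) then P(T_0 = ∞) = (3p − 2)/(2p − 1). -/

import Mathlib

open MeasureTheory Filter

noncomputable section

/-- The hitting time of site `x` by the process `X`, with value `⊤` if `x` is never hit. -/
def hitTime {Ω : Type*} (X : ℕ → Ω → ℤ) (x : ℤ) (ω : Ω) : ℕ∞ :=
  ⨅ (n : ℕ) (_ : X n ω = x), (n : ℕ∞)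

/-- The natural filtration of the process `X` at time `n`. -/
def natSA {Ω : Type*} (X : ℕ → Ω → ℤ) (n : ℕ) : MeasurableSpace Ω :=
  ⨆ m ∈ Finset.range (n + 1), MeasurableSpace.comap (X m) ⊤

/-- The event `A_n` that before time `n` the walk has never jumped leftward from its
current site `X_n`. -/
def freshEvent {Ω : Type*} (X : ℕ → Ω → ℤ) (n : ℕ) : Set Ω :=
  {ω | ∀ m < n, ¬(X m ω = X n ω ∧ X (m + 1) ω = X m ω - 1)}

/-- A random walk in the "have your cookie and eat it" environment `env`. -/
structure IsCookieRW {Ω : Type*} [MeasurableSpace Ω] (P : Measure Ω)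
    (env : ℤ → ℝ) (X : ℕ → Ω → ℤ) : Prop where
  envRange : ∀ x : ℤ, env x ∈ Set.Ico (1 / 2 : ℝ) 1
  meas : ∀ n, Measurable (X n)
  steps : ∀ n : ℕ, ∀ᵐ ω ∂P, |X (n + 1) ω - X n ω| = 1
  cond : ∀ n : ℕ,
    (P[Set.indicator {ω | X (n + 1) ω = X n ω + 1} (fun _ => (1 : ℝ)) | natSA X n])
      =ᵐ[P]
    fun ω => env (X n ω) * Set.indicator (freshEvent X n) (fun _ => (1 : ℝ)) ω
      + (1 / 2) * Set.indicator (freshEvent X n)ᶜ (fun _ => (1 : ℝ)) ω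

/-- Probability of a rightward step from `y` when the sites in `C` have already been left
towards the left. -/
def rightProb (p : ℝ) (C : Set ℤ) (y : ℤ) : ℝ :=
  open Classical in if y ∈ C then 1 / 2 else p

/-- One-step expectation of `f` for the chain of pairs (set of used sites, position). -/
def stepMean (p : ℝ) (f : Set ℤ → ℤ → ℝ) (C : Set ℤ) (y : ℤ) : ℝ :=
  rightProb p C y * f C (y + 1) + (1 - rightProb p C y) * f (insert y C) (y - 1)

/-- Expectation of `b` at the position after `n` steps of the chain stopped on leaving `D`. -/
def stoppedMean (p : ℝ) (D : Set ℤ) (b : ℤ → ℝ) : ℕ → Set ℤ → ℤ → ℝ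
  | 0 => fun _ y => b y
  | n + 1 => fun C y =>
      open Classical in if y ∈ D then stepMean p (stoppedMean p D b n) C y else b y

/-- Probability of reaching `b` before `a` within `n` steps. -/
def hitWithin (p : ℝ) (a b : ℤ) : ℕ → Set ℤ → ℤ → ℝ :=
  stoppedMean p (Set.Ioo a b) (fun y => if b ≤ y then 1 else 0)

/-- Probability of reaching `b` before `a`. -/
def hitProb (p : ℝ) (a b : ℤ) (C : Set ℤ) (y : ℤ) : ℝ :=
  ⨆ n, hitWithin p a b n C y

/-- Probability of avoiding `0` during `n` steps. -/
def avoidWithin (p : ℝ) : ℕ → Set ℤ → ℤ → ℝ :=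
  stoppedMean p {0}ᶜ (fun y => if y = 0 then 0 else 1)

section Deterministic

variable {p : ℝ}

lemma rightProb_mem (hp : p ∈ Set.Icc (1 / 2 : ℝ) 1) (C : Set ℤ) (y : ℤ) :
    rightProb p C y ∈ Set.Icc (1 / 2 : ℝ) 1 := by
  unfold rightProb
  split_ifs
  · constructor <;> norm_num
  · exact hp

lemma stepMean_mono (hp : p ∈ Set.Icc (1 / 2 : ℝ) 1) {f g : Set ℤ → ℤ → ℝ} {C : Set ℤ} {y : ℤ}
    (hr : f C (y + 1) ≤ g C (y + 1)) (hl : f (insert y C) (y - 1) ≤ g (insert y C) (y - 1)) :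
    stepMean p f C y ≤ stepMean p g C y := by
  obtain ⟨h1, h2⟩ := rightProb_mem hp C y
  unfold stepMean
  gcongr

lemma stepMean_const (c : ℝ) (C : Set ℤ) (y : ℤ) : stepMean p (fun _ _ => c) C y = c := by
  unfold stepMean; ring

lemma stoppedMean_of_notMem {D : Set ℤ} (b : ℤ → ℝ) (n : ℕ) (C : Set ℤ) {y : ℤ} (hy : y ∉ D) :
    stoppedMean p D b n C y = b y := by
  cases n <;> simp [stoppedMean, hy]

lemma stoppedMean_succ_of_mem {D : Set ℤ} (b : ℤ → ℝ) (n : ℕ) (C : Set ℤ) {y : ℤ} (hy : y ∈ D) :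
    stoppedMean p D b (n + 1) C y = stepMean p (stoppedMean p D b n) C y := by
  simp [stoppedMean, hy]

lemma stoppedMean_mem_Icc (hp : p ∈ Set.Icc (1 / 2 : ℝ) 1) {D : Set ℤ} {b : ℤ → ℝ}
    (hb : ∀ y, b y ∈ Set.Icc (0 : ℝ) 1) (n : ℕ) (C : Set ℤ) (y : ℤ) :
    stoppedMean p D b n C y ∈ Set.Icc (0 : ℝ) 1 := by
  induction n generalizing C y with
  | zero => exact hb y
  | succ n ih =>
    by_cases hy : y ∈ D
    · rw [stoppedMean_succ_of_mem _ _ _ hy, Set.mem_Icc]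
      constructor
      · rw [← stepMean_const (p := p) 0 C y]
        exact stepMean_mono hp (ih _ _).1 (ih _ _).1
      · rw [← stepMean_const (p := p) 1 C y]
        exact stepMean_mono hp (ih _ _).2 (ih _ _).2
    · rw [stoppedMean_of_notMem _ _ _ hy]
      exact hb y

lemma hitWithin_mem_Icc (hp : p ∈ Set.Icc (1 / 2 : ℝ) 1) (a b : ℤ) (n : ℕ) (C : Set ℤ) (y : ℤ) :
    hitWithin p a b n C y ∈ Set.Icc (0 : ℝ) 1 :=
  stoppedMean_mem_Icc hp (fun y => by split_ifs <;> norm_num) n C y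

lemma avoidWithin_mem_Icc (hp : p ∈ Set.Icc (1 / 2 : ℝ) 1) (n : ℕ) (C : Set ℤ) (y : ℤ) :
    avoidWithin p n C y ∈ Set.Icc (0 : ℝ) 1 :=
  stoppedMean_mem_Icc hp (fun y => by split_ifs <;> norm_num) n C y

lemma hitWithin_monotone (hp : p ∈ Set.Icc (1 / 2 : ℝ) 1) (a b : ℤ) (C : Set ℤ) (y : ℤ) :
    Monotone fun n => hitWithin p a b n C y := by
  refine monotone_nat_of_le_succ fun n => ?_
  induction n generalizing C y with
  | zero =>
    by_cases hy : y ∈ Set.Ioo a b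
    · have h0 : hitWithin p a b 0 C y = 0 := if_neg (not_le.2 hy.2)
      rw [h0]
      exact (hitWithin_mem_Icc hp a b _ C y).1
    · simp only [hitWithin, stoppedMean_of_notMem _ _ _ hy, le_refl]
  | succ n ih =>
    by_cases hy : y ∈ Set.Ioo a b
    · simp only [hitWithin, stoppedMean_succ_of_mem _ _ _ hy]
      exact stepMean_mono hp (ih _ _) (ih _ _)
    · simp only [hitWithin, stoppedMean_of_notMem _ _ _ hy, le_refl]

lemma avoidWithin_antitone (hp : p ∈ Set.Icc (1 / 2 : ℝ) 1) (C : Set ℤ) (y : ℤ) :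
    Antitone fun n => avoidWithin p n C y := by
  refine antitone_nat_of_succ_le fun n => ?_
  induction n generalizing C y with
  | zero =>
    by_cases hy : y ∈ ({0}ᶜ : Set ℤ)
    · have h0 : avoidWithin p 0 C y = 1 := if_neg hy
      rw [h0]
      exact (avoidWithin_mem_Icc hp _ C y).2
    · simp only [avoidWithin, stoppedMean_of_notMem _ _ _ hy, le_refl]
  | succ n ih =>
    by_cases hy : y ∈ ({0}ᶜ : Set ℤ)
    · simp only [avoidWithin, stoppedMean_succ_of_mem _ _ _ hy]
      exact stepMean_mono hp (ih _ _) (ih _ _)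
    · simp only [avoidWithin, stoppedMean_of_notMem _ _ _ hy, le_refl]

lemma eq_stepMean_of_tendsto {D : Set ℤ} {b : ℤ → ℝ} {L : Set ℤ → ℤ → ℝ}
    (hL : ∀ C y, Tendsto (fun n => stoppedMean p D b n C y) atTop (nhds (L C y)))
    {C : Set ℤ} {y : ℤ} (hy : y ∈ D) : L C y = stepMean p L C y := by
  refine tendsto_nhds_unique ((tendsto_add_atTop_iff_nat 1).2 (hL C y)) ?_
  simp only [stoppedMean_succ_of_mem _ _ _ hy]
  exact ((hL _ _).const_mul _).add ((hL _ _).const_mul _)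

lemma tendsto_hitWithin (hp : p ∈ Set.Icc (1 / 2 : ℝ) 1) (a b : ℤ) (C : Set ℤ) (y : ℤ) :
    Tendsto (fun n => hitWithin p a b n C y) atTop (nhds (hitProb p a b C y)) :=
  tendsto_atTop_ciSup (hitWithin_monotone hp a b C y)
    ⟨1, by rintro _ ⟨n, rfl⟩; exact (hitWithin_mem_Icc hp a b n C y).2⟩

lemma hitProb_mem_Icc (hp : p ∈ Set.Icc (1 / 2 : ℝ) 1) (a b : ℤ) (C : Set ℤ) (y : ℤ) :
    hitProb p a b C y ∈ Set.Icc (0 : ℝ) 1 :=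
  isClosed_Icc.mem_of_tendsto (tendsto_hitWithin hp a b C y)
    (Eventually.of_forall fun n => hitWithin_mem_Icc hp a b n C y)

lemma hitProb_eq_stepMean (hp : p ∈ Set.Icc (1 / 2 : ℝ) 1) {a b : ℤ} (C : Set ℤ) {y : ℤ}
    (hy : y ∈ Set.Ioo a b) : hitProb p a b C y = stepMean p (hitProb p a b) C y :=
  eq_stepMean_of_tendsto (tendsto_hitWithin hp a b) hy

lemma hitProb_of_le_left {a b : ℤ} (hab : a < b) (C : Set ℤ) {y : ℤ} (hy : y ≤ a) :
    hitProb p a b C y = 0 := by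
  have h : ∀ n, hitWithin p a b n C y = 0 := fun n => by
    rw [hitWithin, stoppedMean_of_notMem _ _ _ (fun h => absurd h.1 (not_lt.2 hy)),
      if_neg (by omega)]
  simp [hitProb, h]

lemma hitProb_of_right_le {a b : ℤ} (C : Set ℤ) {y : ℤ} (hy : b ≤ y) :
    hitProb p a b C y = 1 := by
  have h : ∀ n, hitWithin p a b n C y = 1 := fun n => by
    rw [hitWithin, stoppedMean_of_notMem _ _ _ (fun h => absurd h.2 (not_lt.2 hy)), if_pos hy]
  simp [hitProb, h]

/-- The hitting probabilities only depend on the used sites strictly between the two targets, and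
are invariant under translations. -/
lemma hitProb_congr_shift {a b k : ℤ} {C C' : Set ℤ}
    (hC : ∀ z ∈ Set.Ioo a b, z + k ∈ C' ↔ z ∈ C) (y : ℤ) :
    hitProb p (a + k) (b + k) C' (y + k) = hitProb p a b C y := by
  have key : ∀ (n : ℕ) (C C' : Set ℤ) (y : ℤ), (∀ z ∈ Set.Ioo a b, z + k ∈ C' ↔ z ∈ C) →
      hitWithin p (a + k) (b + k) n C' (y + k) = hitWithin p a b n C y := by
    intro n
    induction n with
    | zero => intro C C' y _; simp [hitWithin, stoppedMean]
    | succ n ih =>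
      intro C C' y hC
      by_cases hy : y ∈ Set.Ioo a b
      · have hy' : y + k ∈ Set.Ioo (a + k) (b + k) := by simpa using hy
        have h1 := ih C C' (y + 1) hC
        have h2 := ih (insert y C) (insert (y + k) C') (y - 1) fun z hz => by
          simp [hC z hz]
        have h3 : rightProb p C' (y + k) = rightProb p C y := by
          have := hC y hy
          by_cases h : y ∈ C <;> simp_all [rightProb]
        simp only [hitWithin] at h1 h2 ⊢
        rw [stoppedMean_succ_of_mem _ _ _ hy, stoppedMean_succ_of_mem _ _ _ hy']
        simp only [stepMean]
        rw [h3, ← h1, ← h2]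
        congr 3 <;> ring_nf
      · have hy' : y + k ∉ Set.Ioo (a + k) (b + k) := by simpa using hy
        simp only [hitWithin, stoppedMean_of_notMem _ _ _ hy, stoppedMean_of_notMem _ _ _ hy']
        simp
  simp only [hitProb, key _ C C' y hC]

lemma hitProb_anti_right (hp : p ∈ Set.Icc (1 / 2 : ℝ) 1) {a b c : ℤ} (hbc : b ≤ c)
    (C : Set ℤ) (y : ℤ) : hitProb p a c C y ≤ hitProb p a b C y := by
  refine le_of_tendsto_of_tendsto' (tendsto_hitWithin hp a c C y) (tendsto_hitWithin hp a b C y)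
    fun n => ?_
  induction n generalizing C y with
  | zero => simp only [hitWithin, stoppedMean]; split_ifs <;> first | omega | norm_num
  | succ n ih =>
    by_cases hy : y ∈ Set.Ioo a b
    · have hy' : y ∈ Set.Ioo a c := ⟨hy.1, hy.2.trans_le hbc⟩
      simp only [hitWithin, stoppedMean_succ_of_mem _ _ _ hy, stoppedMean_succ_of_mem _ _ _ hy']
      exact stepMean_mono hp (ih _ _) (ih _ _)
    · by_cases hb : b ≤ y
      · rw [hitWithin.eq_1 p a b, stoppedMean_of_notMem _ _ _ hy, if_pos hb]
        exact (hitWithin_mem_Icc hp a c _ C y).2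
      · have hy' : y ∉ Set.Ioo a c := fun h => hy ⟨h.1, not_le.1 hb⟩
        simp only [hitWithin, stoppedMean_of_notMem _ _ _ hy, stoppedMean_of_notMem _ _ _ hy']
        rw [if_neg hb, if_neg (by omega)]

/-- Maximum principle on `(0, N)`, for states in a set `S` stable under the chain. -/
lemma nonpos_of_le_stepMean (hp : p ∈ Set.Icc (1 / 2 : ℝ) 1) {N : ℤ} {S : Set ℤ → ℤ → Prop}
    (hSr : ∀ C y, S C y → S C (y + 1)) (hSl : ∀ C y, S C y → S (insert y C) (y - 1))
    {g : Set ℤ → ℤ → ℝ} {K : ℝ} (hK : 0 ≤ K)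
    (hgK : ∀ C y, 0 < y → y < N → g C y ≤ K)
    (hsub : ∀ C y, S C y → 0 < y → y < N → g C y ≤ stepMean p g C y)
    (h0 : ∀ C, S C 0 → g C 0 ≤ 0) (hN : ∀ C, S C N → g C N ≤ 0)
    {C : Set ℤ} {y : ℤ} (hS : S C y) (hy0 : 0 ≤ y) (hyN : y ≤ N) : g C y ≤ 0 := by
  rcases hy0.eq_or_lt with rfl | hy0'
  · exact h0 C hS
  have hN0 : (1 : ℝ) ≤ N := by exact_mod_cast (by omega : (1 : ℤ) ≤ N)
  set r : ℝ := 1 - 1 / (N : ℝ) ^ 2 with hr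
  have hN2 : (1 : ℝ) ≤ (N : ℝ) ^ 2 := by nlinarith
  have hr0 : 0 ≤ r := by
    rw [hr, sub_nonneg, div_le_one (by positivity)]
    exact hN2
  have hr1 : r < 1 := by
    have : 0 < 1 / (N : ℝ) ^ 2 := by positivity
    linarith
  have key : ∀ (n : ℕ) (C : Set ℤ) (y : ℤ), S C y → 0 ≤ y → y ≤ N →
      g C y ≤ K * r ^ n * ((N : ℝ) ^ 2 - (y : ℝ) ^ 2) := by
    intro n
    induction n with
    | zero =>
      intro C y hS hy0 hyN
      rcases hy0.eq_or_lt with rfl | hy0'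
      · refine (h0 C hS).trans ?_
        simp only [pow_zero, Int.cast_zero]
        nlinarith
      rcases hyN.eq_or_lt with rfl | hyN'
      · simpa using hN C hS
      refine (hgK C y hy0' hyN').trans ?_
      have h1 : (y : ℝ) + 1 ≤ N := by exact_mod_cast hyN'
      have h2 : (0 : ℝ) < y := by exact_mod_cast hy0'
      have : (1 : ℝ) ≤ (N : ℝ) ^ 2 - (y : ℝ) ^ 2 := by nlinarith
      simp only [pow_zero, mul_one]
      nlinarith
    | succ n ih =>
      intro C y hS hy0 hyN
      have hKr : 0 ≤ K * r ^ n := by positivity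
      rcases hy0.eq_or_lt with rfl | hy0'
      · refine (h0 C hS).trans ?_
        have : 0 ≤ K * r ^ (n + 1) := by positivity
        simp only [Int.cast_zero]
        nlinarith
      rcases hyN.eq_or_lt with rfl | hyN'
      · simpa using hN C hS
      have h2 : (0 : ℝ) < y := by exact_mod_cast hy0'
      obtain ⟨hw1, hw2⟩ := rightProb_mem hp C y
      calc g C y ≤ stepMean p g C y := hsub C y hS hy0' hyN'
        _ ≤ stepMean p (fun _ z => K * r ^ n * ((N : ℝ) ^ 2 - (z : ℝ) ^ 2)) C y :=
            stepMean_mono hp (ih _ _ (hSr C y hS) (by omega) (by omega))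
              (ih _ _ (hSl C y hS) (by omega) (by omega))
        _ = K * r ^ n * ((N : ℝ) ^ 2 - (y : ℝ) ^ 2 - 1
              - 2 * y * (2 * rightProb p C y - 1)) := by
            simp only [stepMean]; push_cast; ring
        _ ≤ K * r ^ n * (r * ((N : ℝ) ^ 2 - (y : ℝ) ^ 2)) := by
            refine mul_le_mul_of_nonneg_left ?_ hKr
            have e : r * ((N : ℝ) ^ 2 - (y : ℝ) ^ 2)
                = (N : ℝ) ^ 2 - (y : ℝ) ^ 2 - 1 + (y : ℝ) ^ 2 / (N : ℝ) ^ 2 := by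
              rw [hr]; field_simp; ring
            have : 0 ≤ (y : ℝ) ^ 2 / (N : ℝ) ^ 2 := by positivity
            have : 0 ≤ 2 * y * (2 * rightProb p C y - 1) :=
              mul_nonneg (by positivity) (by linarith)
            linarith
        _ = _ := by rw [pow_succ]; ring
  have hlim : Tendsto (fun n : ℕ => K * r ^ n * ((N : ℝ) ^ 2 - (y : ℝ) ^ 2)) atTop (nhds 0) := by
    simpa using ((tendsto_pow_atTop_nhds_zero_of_lt_one hr0 hr1).const_mul K).mul_const
      ((N : ℝ) ^ 2 - (y : ℝ) ^ 2)
  exact ge_of_tendsto' hlim fun n => key n C y hS hy0 hyN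

/-- The used sites to the right of `y` form an interval starting at `y + 1`. -/
def IntervalAhead (C : Set ℤ) (y : ℤ) : Prop :=
  ∀ z ∈ C, ∀ x, y < x → x ≤ z → x ∈ C

lemma IntervalAhead.right {C : Set ℤ} {y : ℤ} (h : IntervalAhead C y) :
    IntervalAhead C (y + 1) :=
  fun z hz x hx hxz => h z hz x (by omega) hxz

lemma IntervalAhead.left {C : Set ℤ} {y : ℤ} (h : IntervalAhead C y) :
    IntervalAhead (insert y C) (y - 1) := by
  intro z hz x hx hxz
  rcases eq_or_ne x y with rfl | hxy
  · exact Set.mem_insert _ _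
  rcases hz with rfl | hz
  · omega
  · exact Set.mem_insert_of_mem _ (h z hz x (by omega) hxz)

/-- Probability that `x` gets used before the chain leaves `(0, N)`. -/
def useProb (p : ℝ) (N x : ℤ) (C : Set ℤ) (y : ℤ) : ℝ :=
  open Classical in
  if x ∈ C then 1
  else if y < x then hitProb p 0 x C y * (1 - hitProb p 0 (N - x + 1) ∅ 1)
  else 1 - hitProb p (x - 1) N C y

lemma useProb_mem_Icc (hp : p ∈ Set.Icc (1 / 2 : ℝ) 1) (N x : ℤ) (C : Set ℤ) (y : ℤ) :
    useProb p N x C y ∈ Set.Icc (0 : ℝ) 1 := by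
  unfold useProb
  have h1 := hitProb_mem_Icc hp 0 x C y
  have h2 := hitProb_mem_Icc hp 0 (N - x + 1) ∅ 1
  have h3 := hitProb_mem_Icc hp (x - 1) N C y
  simp only [Set.mem_Icc] at *
  split_ifs
  · norm_num
  · constructor <;> nlinarith
  · constructor <;> linarith

lemma useProb_eq_stepMean (hp : p ∈ Set.Icc (1 / 2 : ℝ) 1) {N x : ℤ} (hx0 : 0 < x) (hxN : x < N)
    {C : Set ℤ} {y : ℤ} (hC : IntervalAhead C y) (hy0 : 0 < y) (hyN : y < N) :
    useProb p N x C y = stepMean p (useProb p N x) C y := by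
  by_cases hxC : x ∈ C
  · simp [useProb, stepMean, hxC]
  rcases lt_trichotomy y x with hyx | rfl | hyx
  · have hr : useProb p N x C (y + 1)
        = hitProb p 0 x C (y + 1) * (1 - hitProb p 0 (N - x + 1) ∅ 1) := by
      rcases (show y + 1 ≤ x by omega).eq_or_lt with h | h
      · have hs := hitProb_congr_shift (p := p) (a := 0) (b := N - x + 1) (k := x - 1) (C := ∅)
          (C' := C) (fun z hz => by
            simp only [Set.mem_empty_iff_false, iff_false]
            exact fun hzC => hxC (hC _ hzC x hyx (by have := hz.1; omega))) 1
        rw [h, hitProb_of_right_le _ le_rfl, one_mul, ← hs]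
        simp only [useProb, hxC, if_false, lt_irrefl]
        congr 2 <;> ring
      · simp [useProb, hxC, h]
    have hl : useProb p N x (insert y C) (y - 1)
        = hitProb p 0 x (insert y C) (y - 1) * (1 - hitProb p 0 (N - x + 1) ∅ 1) := by
      have : x ∉ insert y C := by simp [hxC, hyx.ne']
      simp [useProb, this, show y - 1 < x by omega]
    have h0 : useProb p N x C y = hitProb p 0 x C y * (1 - hitProb p 0 (N - x + 1) ∅ 1) := by
      simp [useProb, hxC, hyx]
    rw [h0, hitProb_eq_stepMean hp C ⟨hy0, hyx⟩, stepMean, stepMean, hr, hl]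
    ring
  · have h0 : useProb p N y C y = 1 - hitProb p (y - 1) N C y := by simp [useProb, hxC]
    have hr : useProb p N y C (y + 1) = 1 - hitProb p (y - 1) N C (y + 1) := by
      simp [useProb, hxC]
    have hl : useProb p N y (insert y C) (y - 1) = 1 := by simp [useProb]
    rw [h0, hitProb_eq_stepMean hp C ⟨by omega, hyN⟩, stepMean, stepMean, hr, hl,
      hitProb_of_le_left (by omega) _ le_rfl]
    ring
  · have h0 : useProb p N x C y = 1 - hitProb p (x - 1) N C y := by
      simp [useProb, hxC, hyx.not_gt]
    have hr : useProb p N x C (y + 1) = 1 - hitProb p (x - 1) N C (y + 1) := by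
      simp [useProb, hxC, show ¬ y + 1 < x by omega]
    have hl : useProb p N x (insert y C) (y - 1)
        = 1 - hitProb p (x - 1) N (insert y C) (y - 1) := by
      have : x ∉ insert y C := by simp [hxC, hyx.ne]
      simp [useProb, this, show ¬ y - 1 < x by omega]
    rw [h0, hitProb_eq_stepMean hp C ⟨by omega, hyN⟩, stepMean, stepMean, hr, hl]
    ring

open Classical in
/-- Number of used sites among `1, …, n`. -/
def usedCount (n : ℕ) (C : Set ℤ) : ℝ :=
  ∑ i ∈ Finset.range n, if ((i : ℤ) + 1) ∈ C then 1 else 0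

lemma usedCount_insert {n : ℕ} {C : Set ℤ} {y : ℤ} (hy0 : 0 < y) (hyn : y < n + 1) (hy : y ∉ C) :
    usedCount n (insert y C) = usedCount n C + 1 := by
  classical
  obtain ⟨j, rfl⟩ : ∃ j : ℕ, y = j + 1 := ⟨(y - 1).toNat, by omega⟩
  have h : ∀ i ∈ Finset.range n, (if ((i : ℤ) + 1) ∈ insert ((j : ℤ) + 1) C then (1 : ℝ) else 0)
      = (if ((i : ℤ) + 1) ∈ C then 1 else 0) + if i = j then 1 else 0 := by
    intro i _
    by_cases hij : i = j
    · subst hij; simp [hy]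
    · simp [hij]
  have hs := Finset.sum_congr rfl h
  rw [Finset.sum_add_distrib, Finset.sum_ite_eq', if_pos (Finset.mem_range.2 (by omega))] at hs
  unfold usedCount
  convert hs

lemma usedCount_mem_Icc (n : ℕ) (C : Set ℤ) : usedCount n C ∈ Set.Icc (0 : ℝ) n := by
  classical
  constructor
  · exact Finset.sum_nonneg fun i _ => by split_ifs <;> norm_num
  · calc usedCount n C ≤ ∑ i ∈ Finset.range n, (1 : ℝ) :=
          Finset.sum_le_sum fun i _ => by split_ifs <;> norm_num
      _ = n := by simp

/-- Position minus compensated number of used sites is harmonic. -/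
lemma sub_usedCount_eq_stepMean (hp1 : p < 1) {n : ℕ} (C : Set ℤ) {y : ℤ} (hy0 : 0 < y)
    (hyn : y < n + 1) :
    (y : ℝ) - (2 * p - 1) / (1 - p) * usedCount n C
      = stepMean p (fun C y => (y : ℝ) - (2 * p - 1) / (1 - p) * usedCount n C) C y := by
  have : 1 - p ≠ 0 := by linarith
  by_cases hy : y ∈ C
  · simp only [stepMean, rightProb, hy, if_true, Set.insert_eq_of_mem]
    push_cast; ring
  · simp only [stepMean, rightProb, hy, if_false, usedCount_insert hy0 hyn hy]
    push_cast; field_simp; ring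

lemma sum_useProb_boundary (n : ℕ) (C : Set ℤ) {y : ℤ} (hy : y = 0 ∨ y = n + 1) :
    ∑ i ∈ Finset.range n, useProb p (n + 1) (i + 1) C y = usedCount n C := by
  refine Finset.sum_congr rfl fun i hi => ?_
  have hi := Finset.mem_range.1 hi
  by_cases hC : (i : ℤ) + 1 ∈ C
  · simp [useProb, hC]
  · rcases hy with rfl | rfl
    · simp [useProb, hC, show (0 : ℤ) < i + 1 by omega, hitProb_of_le_left]
    · simp [useProb, hC, show ¬ ((n : ℤ) + 1 < i + 1) by omega, hitProb_of_right_le]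

/-- Optional stopping for `position - δ * usedCount`, on leaving `(0, n + 1)`. -/
lemma sub_usedCount_eq (hp : p ∈ Set.Ico (1 / 2 : ℝ) 1) (n : ℕ) {C : Set ℤ} {y : ℤ}
    (hC : IntervalAhead C y) (hy0 : 0 ≤ y) (hyn : y ≤ n + 1) :
    (y : ℝ) - (2 * p - 1) / (1 - p) * usedCount n C
      = (n + 1) * hitProb p 0 (n + 1) C y
        - (2 * p - 1) / (1 - p) * ∑ i ∈ Finset.range n, useProb p (n + 1) (i + 1) C y := by
  have hp' : p ∈ Set.Icc (1 / 2 : ℝ) 1 := ⟨hp.1, hp.2.le⟩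
  set δ := (2 * p - 1) / (1 - p) with hδ
  have hδ0 : 0 ≤ δ := div_nonneg (by linarith [hp.1]) (by linarith [hp.2])
  set g : Set ℤ → ℤ → ℝ := fun C y => ((y : ℝ) - δ * usedCount n C)
    - ((n + 1) * hitProb p 0 (n + 1) C y
      - δ * ∑ i ∈ Finset.range n, useProb p (n + 1) (i + 1) C y) with hg
  have hharm : ∀ C y, IntervalAhead C y → 0 < y → y < (n : ℤ) + 1 → g C y = stepMean p g C y := by
    intro C y hC hy0 hyn
    have e1 := sub_usedCount_eq_stepMean hp.2 C hy0 hyn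
    have e2 := hitProb_eq_stepMean hp' C (show y ∈ Set.Ioo 0 ((n : ℤ) + 1) from ⟨hy0, hyn⟩)
    have e3 : ∑ i ∈ Finset.range n, useProb p (n + 1) (i + 1) C y
        = stepMean p (fun C y => ∑ i ∈ Finset.range n, useProb p (n + 1) (i + 1) C y) C y := by
      simp only [stepMean, Finset.mul_sum, ← Finset.sum_add_distrib]
      refine Finset.sum_congr rfl fun i hi => ?_
      have hi := Finset.mem_range.1 hi
      exact useProb_eq_stepMean hp' (by omega) (by omega) hC hy0 hyn
    simp only [hg]
    rw [e1, e2, e3]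
    simp only [stepMean]
    ring
  have hbdry : ∀ C y, (y = 0 ∨ y = (n : ℤ) + 1) → g C y = 0 := by
    intro C y hy
    simp only [hg, sum_useProb_boundary n C hy]
    rcases hy with rfl | rfl
    · rw [hitProb_of_le_left (by omega) _ le_rfl]; simp
    · rw [hitProb_of_right_le _ le_rfl]; push_cast; ring
  have hbound : ∀ C y, 0 < y → y < (n : ℤ) + 1 → |g C y| ≤ 2 * (n + 1) + 2 * δ * n := by
    intro C y hy0 hyn
    have a1 : (0 : ℝ) ≤ y := by exact_mod_cast hy0.le
    have a2 : (y : ℝ) ≤ n + 1 := by exact_mod_cast hyn.le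
    obtain ⟨b1, b2⟩ := usedCount_mem_Icc n C
    obtain ⟨c1, c2⟩ := hitProb_mem_Icc hp' 0 (n + 1) C y
    have d1 : 0 ≤ ∑ i ∈ Finset.range n, useProb p (n + 1) (i + 1) C y :=
      Finset.sum_nonneg fun i _ => (useProb_mem_Icc hp' _ _ _ _).1
    have d2 : ∑ i ∈ Finset.range n, useProb p (n + 1) (i + 1) C y ≤ n := by
      calc _ ≤ ∑ i ∈ Finset.range n, (1 : ℝ) :=
            Finset.sum_le_sum fun i _ => (useProb_mem_Icc hp' _ _ _ _).2
        _ = n := by simp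
    have n0 : (0 : ℝ) ≤ n := n.cast_nonneg
    have f1 := mul_nonneg hδ0 b1
    have f2 := mul_le_mul_of_nonneg_left b2 hδ0
    have f3 := mul_nonneg hδ0 d1
    have f4 := mul_le_mul_of_nonneg_left d2 hδ0
    have f5 : 0 ≤ ((n : ℝ) + 1) * hitProb p 0 (n + 1) C y := by positivity
    have f6 : ((n : ℝ) + 1) * hitProb p 0 (n + 1) C y ≤ n + 1 := by nlinarith
    rw [abs_le]
    simp only [hg]
    constructor <;> linarith
  have hK : 0 ≤ 2 * ((n : ℝ) + 1) + 2 * δ * n := by positivity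
  have hle : g C y ≤ 0 :=
    nonpos_of_le_stepMean hp' (fun _ _ h => h.right) (fun _ _ h => h.left) hK
      (fun C y h1 h2 => (abs_le.1 (hbound C y h1 h2)).2) (fun C y h h1 h2 => (hharm C y h h1 h2).le)
      (fun C _ => (hbdry C 0 (Or.inl rfl)).le) (fun C _ => (hbdry C _ (Or.inr rfl)).le) hC hy0 hyn
  have hge : -g C y ≤ 0 :=
    nonpos_of_le_stepMean (g := fun C y => -g C y) hp' (fun _ _ h => h.right) (fun _ _ h => h.left)
      hK (fun C y h1 h2 => neg_le.1 (abs_le.1 (hbound C y h1 h2)).1)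
      (fun C y h h1 h2 => by rw [hharm C y h h1 h2, stepMean, stepMean]; linarith)
      (fun C _ => by simp [hbdry C 0 (Or.inl rfl)])
      (fun C _ => by simp [hbdry C _ (Or.inr rfl)]) hC hy0 hyn
  have : g C y = 0 := le_antisymm hle (by linarith)
  exact sub_eq_zero.1 this

lemma hitProb_recursion (hp : p ∈ Set.Ico (1 / 2 : ℝ) 1) (n : ℕ) :
    ((n : ℝ) + 1) * hitProb p 0 (n + 1) ∅ 1
      = 1 + (2 * p - 1) / (1 - p) * ∑ i ∈ Finset.range n,
        hitProb p 0 (i + 1) ∅ 1 * (1 - hitProb p 0 ((n - i : ℕ) + 1) ∅ 1) := by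
  have h := sub_usedCount_eq hp n (C := ∅) (y := 1) (fun z hz => absurd hz (Set.notMem_empty z))
    zero_le_one (by omega)
  have hs : ∑ i ∈ Finset.range n, useProb p (n + 1) (i + 1) ∅ 1 = ∑ i ∈ Finset.range n,
      hitProb p 0 (i + 1) ∅ 1 * (1 - hitProb p 0 ((n - i : ℕ) + 1) ∅ 1) := by
    refine Finset.sum_congr rfl fun i hi => ?_
    have hi := Finset.mem_range.1 hi
    rcases i.eq_zero_or_pos with rfl | hi0
    · simp [useProb, hitProb_of_right_le]
    · simp [useProb, show (1 : ℤ) < i + 1 by omega, Nat.cast_sub hi.le]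
  have hu : usedCount n ∅ = 0 := by simp [usedCount]
  rw [hs, hu] at h
  push_cast at h
  linarith

lemma hitProb_le_avoidWithin (hp : p ∈ Set.Icc (1 / 2 : ℝ) 1) (n : ℕ) {N : ℤ} (hN : 0 < N)
    (C : Set ℤ) {y : ℤ} (hy0 : 0 ≤ y) (hyN : y + n ≤ N) :
    hitProb p 0 N C y ≤ avoidWithin p n C y := by
  rcases hy0.eq_or_lt with rfl | hy
  · rw [hitProb_of_le_left hN _ le_rfl]
    exact (avoidWithin_mem_Icc hp n C 0).1
  induction n generalizing C y with
  | zero =>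
    have h0 : avoidWithin p 0 C y = 1 := if_neg hy.ne'
    rw [h0]
    exact (hitProb_mem_Icc hp 0 N C y).2
  | succ n ih =>
    have ih' : ∀ (C : Set ℤ) (z : ℤ), 0 ≤ z → z + n ≤ N →
        hitProb p 0 N C z ≤ avoidWithin p n C z := by
      intro C z hz hzN
      rcases hz.eq_or_lt with rfl | hz'
      · rw [hitProb_of_le_left hN _ le_rfl]
        exact (avoidWithin_mem_Icc hp n C 0).1
      · exact ih C hz hzN hz'
    push_cast at hyN
    rw [hitProb_eq_stepMean hp C ⟨hy, by omega⟩, avoidWithin,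
      stoppedMean_succ_of_mem _ _ _ (show y ∈ ({0}ᶜ : Set ℤ) from hy.ne')]
    exact stepMean_mono hp (ih' _ _ (by omega) (by omega)) (ih' _ _ (by omega) (by omega))

lemma le_hitProb_of_tendsto_avoidWithin (hp : p ∈ Set.Icc (1 / 2 : ℝ) 1) {N : ℤ} {L : ℝ}
    {C : Set ℤ} {y : ℤ} (hL : Tendsto (fun n => avoidWithin p n C y) atTop (nhds L))
    (hy0 : 0 ≤ y) (hyN : y ≤ N) : L ≤ hitProb p 0 N C y := by
  have hbdd : ∀ C y, BddBelow (Set.range fun n => avoidWithin p n C y) := fun C y =>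
    ⟨0, by rintro _ ⟨n, rfl⟩; exact (avoidWithin_mem_Icc hp n C y).1⟩
  set s : Set ℤ → ℤ → ℝ := fun C y => ⨅ n, avoidWithin p n C y with hs
  have hlim : ∀ C y, Tendsto (fun n => avoidWithin p n C y) atTop (nhds (s C y)) := fun C y =>
    tendsto_atTop_ciInf (avoidWithin_antitone hp C y) (hbdd C y)
  have hs1 : ∀ C y, s C y ≤ 1 := fun C y =>
    (ciInf_le (hbdd C y) 0).trans (avoidWithin_mem_Icc hp 0 C y).2
  have hs0 : ∀ C, s C 0 = 0 := fun C => by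
    simp only [hs, avoidWithin, stoppedMean_of_notMem _ _ _ (show (0 : ℤ) ∉ ({0}ᶜ : Set ℤ) by simp)]
    simp
  rw [tendsto_nhds_unique hL (hlim C y), ← sub_nonpos]
  refine nonpos_of_le_stepMean (p := p) (N := N) (S := fun _ _ => True)
    (g := fun C y => s C y - hitProb p 0 N C y) hp (fun _ _ _ => trivial) (fun _ _ _ => trivial)
    zero_le_one ?_ ?_ ?_ ?_ trivial hy0 hyN
  · intro C y _ _
    linarith [hs1 C y, (hitProb_mem_Icc hp 0 N C y).1]
  · intro C y _ h1 h2
    have e1 := eq_stepMean_of_tendsto hlim (C := C) (show y ∈ ({0}ᶜ : Set ℤ) from h1.ne')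
    have e2 := hitProb_eq_stepMean hp C (show y ∈ Set.Ioo 0 N from ⟨h1, h2⟩)
    rw [e1, e2]
    simp only [stepMean]
    linarith
  · intro C _
    simp only [hs0]
    linarith [(hitProb_mem_Icc hp 0 N C 0).1]
  · intro C _
    simp only [hitProb_of_right_le C (le_refl N)]
    linarith [hs1 C N]

lemma tendsto_hitProb_of_tendsto_avoidWithin (hp : p ∈ Set.Icc (1 / 2 : ℝ) 1) {L : ℝ}
    (hL : Tendsto (fun n => avoidWithin p n ∅ 1) atTop (nhds L)) :
    Tendsto (fun n : ℕ => hitProb p 0 (n + 1) ∅ 1) atTop (nhds L) :=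
  tendsto_of_tendsto_of_tendsto_of_le_of_le tendsto_const_nhds hL
    (fun n => le_hitProb_of_tendsto_avoidWithin hp hL zero_le_one (by omega))
    (fun n => hitProb_le_avoidWithin hp n (by omega) ∅ zero_le_one (by omega))

/-- The limit of an antitone solution of the hitting-probability recursion. -/
lemma mul_one_sub_limit_eq_one {δ L : ℝ} (hδ : 1 < δ) {u : ℕ → ℝ} (hu : Antitone u)
    (hu1 : ∀ n, u n ≤ 1) (hL : Tendsto u atTop (nhds L))
    (hrec : ∀ n : ℕ, ((n : ℝ) + 1) * u n
      = 1 + δ * ∑ i ∈ Finset.range n, u i * (1 - u (n - i))) :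
    δ * (1 - L) = 1 := by
  have hLu : ∀ n, L ≤ u n := fun n => hu.le_of_tendsto hL n
  have hδ0 : 0 < δ := by linarith
  have hpos : ∀ n, 0 < u n := by
    intro n
    induction n using Nat.strong_induction_on with
    | _ n ih =>
      have : 0 ≤ ∑ i ∈ Finset.range n, u i * (1 - u (n - i)) :=
        Finset.sum_nonneg fun i hi =>
          mul_nonneg (ih i (Finset.mem_range.1 hi)).le (by linarith [hu1 (n - i)])
      have h2 : 0 < ((n : ℝ) + 1) * u n := by rw [hrec n]; positivity
      exact pos_of_mul_pos_right h2 (by positivity)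
  have hratio : Tendsto (fun n : ℕ => (n : ℝ)⁻¹) atTop (nhds 0) :=
    tendsto_inv_atTop_nhds_zero_nat
  have hlow : δ * (1 - L) ≤ 1 := by
    have h1 : Tendsto (fun n : ℕ => δ * ((n : ℝ)⁻¹ * ∑ j ∈ Finset.range n, (1 - u (j + 1))))
        atTop (nhds (δ * (1 - L))) :=
      ((((tendsto_add_atTop_iff_nat 1).2 hL).const_sub 1).cesaro).const_mul δ
    have h2 : Tendsto (fun n : ℕ => 1 + (n : ℝ)⁻¹) atTop (nhds 1) := by
      simpa using hratio.const_add 1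
    refine le_of_tendsto_of_tendsto h1 h2 ?_
    filter_upwards [eventually_gt_atTop 0] with n hn
    have hn' : (0 : ℝ) < n := by exact_mod_cast hn
    have hsum : u n * ∑ j ∈ Finset.range n, (1 - u (j + 1))
        ≤ ∑ i ∈ Finset.range n, u i * (1 - u (n - i)) := by
      rw [← Finset.sum_range_reflect, Finset.mul_sum]
      refine Finset.sum_le_sum fun i hi => ?_
      have hi := Finset.mem_range.1 hi
      rw [show n - 1 - i + 1 = n - i by omega]
      exact mul_le_mul_of_nonneg_right (hu hi.le) (by linarith [hu1 (n - i)])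
    have h3 : u n * (δ * ∑ j ∈ Finset.range n, (1 - u (j + 1))) ≤ u n * (n + 1) := by
      have := mul_le_mul_of_nonneg_left hsum hδ0.le
      linarith [hrec n]
    have h4 := le_of_mul_le_mul_left h3 (hpos n)
    calc δ * ((n : ℝ)⁻¹ * ∑ j ∈ Finset.range n, (1 - u (j + 1)))
        = (n : ℝ)⁻¹ * (δ * ∑ j ∈ Finset.range n, (1 - u (j + 1))) := by ring
      _ ≤ (n : ℝ)⁻¹ * (n + 1) := by gcongr
      _ = 1 + (n : ℝ)⁻¹ := by field_simp
  have hL0 : 0 < L := by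
    by_contra h
    nlinarith
  have hup : L ≤ δ * (1 - L) * L := by
    have h1 : Tendsto (fun n : ℕ => (n : ℝ)⁻¹ + δ * (1 - L)
        * ((n : ℝ)⁻¹ * ∑ i ∈ Finset.range n, u i)) atTop (nhds (0 + δ * (1 - L) * L)) :=
      hratio.add (hL.cesaro.const_mul _)
    rw [zero_add] at h1
    refine ge_of_tendsto h1 ?_
    filter_upwards [eventually_gt_atTop 0] with n hn
    have hn' : (0 : ℝ) < n := by exact_mod_cast hn
    have hsum : ∑ i ∈ Finset.range n, u i * (1 - u (n - i))
        ≤ (1 - L) * ∑ i ∈ Finset.range n, u i := by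
      rw [Finset.mul_sum]
      refine Finset.sum_le_sum fun i _ => ?_
      rw [mul_comm]
      exact mul_le_mul_of_nonneg_right (by linarith [hLu (n - i)]) (hpos i).le
    have h2 : n * L ≤ 1 + δ * ((1 - L) * ∑ i ∈ Finset.range n, u i) := by
      have h3 := mul_le_mul_of_nonneg_left hsum hδ0.le
      have h4 := mul_le_mul_of_nonneg_left (hLu n) hn'.le
      linarith [hrec n, hpos n]
    calc L = (n : ℝ)⁻¹ * (n * L) := by field_simp
      _ ≤ (n : ℝ)⁻¹ * (1 + δ * ((1 - L) * ∑ i ∈ Finset.range n, u i)) := by gcongr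
      _ = _ := by ring
  have : 1 ≤ δ * (1 - L) := by
    by_contra h
    nlinarith
  linarith

lemma limit_avoidWithin (hp : p ∈ Set.Ioo (2 / 3 : ℝ) 1) {L : ℝ}
    (hL : Tendsto (fun n => avoidWithin p n ∅ 1) atTop (nhds L)) :
    L = (3 * p - 2) / (2 * p - 1) := by
  have hp' : p ∈ Set.Ico (1 / 2 : ℝ) 1 := ⟨by linarith [hp.1], hp.2⟩
  have hp'' : p ∈ Set.Icc (1 / 2 : ℝ) 1 := ⟨hp'.1, hp.2.le⟩
  have h1 : 0 < 1 - p := by linarith [hp.2]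
  have h2 : 0 < 2 * p - 1 := by linarith [hp.1]
  have h := mul_one_sub_limit_eq_one (δ := (2 * p - 1) / (1 - p))
    (by rw [lt_div_iff₀ h1]; linarith [hp.1])
    (u := fun n : ℕ => hitProb p 0 (n + 1) ∅ 1)
    (fun m n hmn => hitProb_anti_right hp'' (by omega) ∅ 1)
    (fun n => (hitProb_mem_Icc hp'' _ _ _ _).2)
    (tendsto_hitProb_of_tendsto_avoidWithin hp'' hL)
    (fun n => hitProb_recursion hp' n)
  field_simp at h ⊢
  linarith

end Deterministic

section Walk

variable {Ω : Type*}

/-- The sites from which the walk has jumped leftward before time `n`. -/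
def usedSites (X : ℕ → Ω → ℤ) (n : ℕ) (ω : Ω) : Set ℤ :=
  {z | ∃ m < n, X m ω = z ∧ X (m + 1) ω = z - 1}

lemma mem_freshEvent_iff (X : ℕ → Ω → ℤ) (n : ℕ) (ω : Ω) :
    ω ∈ freshEvent X n ↔ X n ω ∉ usedSites X n ω := by
  simp only [freshEvent, usedSites, Set.mem_ofPred_eq, not_exists, not_and]
  refine forall₂_congr fun m _ => ⟨fun h h1 h2 => h h1 (h1 ▸ h2), fun h h1 h2 => h h1 (h1 ▸ h2)⟩

lemma usedSites_succ_of_right {X : ℕ → Ω → ℤ} {n : ℕ} {ω : Ω} (h : X (n + 1) ω = X n ω + 1) :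
    usedSites X (n + 1) ω = usedSites X n ω := by
  ext z
  constructor
  · rintro ⟨m, hm, h1, h2⟩
    rcases (Nat.lt_succ_iff.1 hm).eq_or_lt with rfl | hm'
    · omega
    · exact ⟨m, hm', h1, h2⟩
  · rintro ⟨m, hm, h1, h2⟩
    exact ⟨m, by omega, h1, h2⟩

lemma usedSites_succ_of_left {X : ℕ → Ω → ℤ} {n : ℕ} {ω : Ω} (h : X (n + 1) ω = X n ω - 1) :
    usedSites X (n + 1) ω = insert (X n ω) (usedSites X n ω) := by
  ext z
  constructor
  · rintro ⟨m, hm, h1, h2⟩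
    rcases (Nat.lt_succ_iff.1 hm).eq_or_lt with rfl | hm'
    · exact Or.inl h1.symm
    · exact Or.inr ⟨m, hm', h1, h2⟩
  · rintro (rfl | ⟨m, hm, h1, h2⟩)
    · exact ⟨n, by omega, rfl, h⟩
    · exact ⟨m, by omega, h1, h2⟩

lemma usedSites_congr {X : ℕ → Ω → ℤ} {n : ℕ} {ω ω' : Ω} (h : ∀ m ≤ n, X m ω = X m ω') :
    usedSites X n ω = usedSites X n ω' := by
  ext z
  refine exists_congr fun m => and_congr_right fun hm => ?_
  rw [h m (by omega), h (m + 1) (by omega)]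

lemma measurable_natSA_of_determined {X : ℕ → Ω → ℤ} {n : ℕ} {g : Ω → ℝ}
    (hg : ∀ ω ω', (∀ m ≤ n, X m ω = X m ω') → g ω = g ω') : Measurable[natSA X n] g := by
  set v : Ω → (Fin (n + 1) → ℤ) := fun ω i => X i ω with hv
  have hvm : Measurable[natSA X n] v := by
    let _ : MeasurableSpace Ω := natSA X n
    refine measurable_pi_iff.2 fun i => Measurable.mono (comap_measurable (X i)) ?_ le_rfl
    exact le_iSup₂_of_le (i : ℕ) (Finset.mem_range.2 i.2) le_rfl
  have hfac : Function.FactorsThrough g v := fun ω ω' h => hg ω ω' fun m hm =>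
    congr_fun h ⟨m, by omega⟩
  rw [← hfac.extend_comp (fun _ => (0 : ℝ))]
  exact @Measurable.comp Ω _ _ (natSA X n) _ _ _ _ Measurable.of_discrete hvm

lemma natSA_le {m : MeasurableSpace Ω} {X : ℕ → Ω → ℤ} (hX : ∀ n, Measurable (X n)) (n : ℕ) :
    natSA X n ≤ m :=
  iSup₂_le fun m _ => (hX m).comap_le

lemma hitTime_eq_top_iff (X : ℕ → Ω → ℤ) (x : ℤ) (ω : Ω) :
    hitTime X x ω = ⊤ ↔ ∀ n, X n ω ≠ x := by
  simp [hitTime, iInf_eq_top]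

variable [MeasurableSpace Ω] {P : Measure Ω} {p : ℝ} {X : ℕ → Ω → ℤ}

lemma integral_mul_indicator_right [IsProbabilityMeasure P] (hX : IsCookieRW P (fun _ => p) X)
    (n : ℕ) {φ : Ω → ℝ} (hφ : Measurable[natSA X n] φ) (hb : ∀ ω, ‖φ ω‖ ≤ 1) :
    ∫ ω, φ ω * Set.indicator {ω | X (n + 1) ω = X n ω + 1} (fun _ => (1 : ℝ)) ω ∂P
      = ∫ ω, φ ω * rightProb p (usedSites X n ω) (X n ω) ∂P := by
  have hle := natSA_le hX.meas n
  have hset : MeasurableSet {ω | X (n + 1) ω = X n ω + 1} :=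
    measurableSet_eq_fun (hX.meas _) ((hX.meas n).add_const 1)
  have hint : Integrable (Set.indicator {ω | X (n + 1) ω = X n ω + 1} (fun _ => (1 : ℝ))) P :=
    (integrable_const 1).indicator hset
  have hφi : Integrable (φ * Set.indicator {ω | X (n + 1) ω = X n ω + 1} (fun _ => (1 : ℝ))) P :=
    hint.bdd_mul (hφ.mono hle le_rfl).aestronglyMeasurable (Eventually.of_forall hb)
  have h1 := condExp_mul_of_stronglyMeasurable_left hφ.stronglyMeasurable hφi hint
  calc _ = ∫ ω, (P[φ * Set.indicator {ω | X (n + 1) ω = X n ω + 1} (fun _ => (1 : ℝ))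
          | natSA X n]) ω ∂P := (integral_condExp hle).symm
    _ = _ := by
      refine integral_congr_ae ?_
      filter_upwards [h1, hX.cond n] with ω h1 h2
      rw [h1, Pi.mul_apply, h2]
      by_cases h : ω ∈ freshEvent X n
      · have h' := (mem_freshEvent_iff X n ω).1 h
        simp [rightProb, h, h']
      · have h' : X n ω ∈ usedSites X n ω := not_not.1 fun h' => h ((mem_freshEvent_iff X n ω).2 h')
        simp [rightProb, h, h']

open Classical in
lemma integral_avoidWithin_step [IsProbabilityMeasure P] (hX : IsCookieRW P (fun _ => p) X)
    (n k : ℕ) :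
    ∫ ω, (if ∀ m < n, X m ω ≠ 0 then avoidWithin p (k + 1) (usedSites X n ω) (X n ω) else 0) ∂P
      = ∫ ω, (if ∀ m < n + 1, X m ω ≠ 0 then
          avoidWithin p k (usedSites X (n + 1) ω) (X (n + 1) ω) else 0) ∂P := by
  have hp : p ∈ Set.Icc (1 / 2 : ℝ) 1 := ⟨(hX.envRange 0).1, (hX.envRange 0).2.le⟩
  set φ : Ω → ℝ := fun ω => if ∀ m < n + 1, X m ω ≠ 0 then
    avoidWithin p k (usedSites X n ω) (X n ω + 1) else 0 with hφ
  set ψ : Ω → ℝ := fun ω => if ∀ m < n + 1, X m ω ≠ 0 then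
    avoidWithin p k (insert (X n ω) (usedSites X n ω)) (X n ω - 1) else 0 with hψ
  have hind : ∀ ω ω', (∀ m ≤ n, X m ω = X m ω') →
      ((∀ m < n + 1, X m ω ≠ 0) ↔ ∀ m < n + 1, X m ω' ≠ 0) := fun ω ω' h =>
    forall₂_congr fun m hm => by rw [h m (by omega)]
  have hφm : Measurable[natSA X n] φ := measurable_natSA_of_determined fun ω ω' h => by
    simp only [hφ, hind ω ω' h, usedSites_congr h, h n le_rfl]
  have hψm : Measurable[natSA X n] ψ := measurable_natSA_of_determined fun ω ω' h => by
    simp only [hψ, hind ω ω' h, usedSites_congr h, h n le_rfl]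
  have hwm : Measurable[natSA X n] fun ω => rightProb p (usedSites X n ω) (X n ω) :=
    measurable_natSA_of_determined fun ω ω' h => by simp only [usedSites_congr h, h n le_rfl]
  have hφb : ∀ ω, ‖φ ω‖ ≤ 1 := fun ω => by
    simp only [hφ]
    split_ifs
    · rw [Real.norm_eq_abs, abs_le]
      have := avoidWithin_mem_Icc hp k (usedSites X n ω) (X n ω + 1)
      exact ⟨by linarith [this.1], this.2⟩
    · simp
  have hψb : ∀ ω, ‖ψ ω‖ ≤ 1 := fun ω => by
    simp only [hψ]
    split_ifs
    · rw [Real.norm_eq_abs, abs_le]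
      have := avoidWithin_mem_Icc hp k (insert (X n ω) (usedSites X n ω)) (X n ω - 1)
      exact ⟨by linarith [this.1], this.2⟩
    · simp
  have hle := natSA_le hX.meas n
  have hφa := (hφm.mono hle le_rfl).aestronglyMeasurable (μ := P)
  have hψa := (hψm.mono hle le_rfl).aestronglyMeasurable (μ := P)
  have hψi : Integrable ψ P := (integrable_const (1 : ℝ)).mono' hψa (Eventually.of_forall hψb)
  set R : Ω → ℝ := Set.indicator {ω | X (n + 1) ω = X n ω + 1} (fun _ => (1 : ℝ)) with hR
  have hRi : Integrable R P := (integrable_const 1).indicator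
    (measurableSet_eq_fun (hX.meas _) ((hX.meas n).add_const 1))
  set W : Ω → ℝ := fun ω => rightProb p (usedSites X n ω) (X n ω) with hW
  have hWi : Integrable W P := (integrable_const (1 : ℝ)).mono'
    (hwm.mono hle le_rfl).aestronglyMeasurable (Eventually.of_forall fun ω => by
      have := rightProb_mem hp (usedSites X n ω) (X n ω)
      rw [Real.norm_eq_abs, abs_le]
      exact ⟨by linarith [this.1], this.2⟩)
  have hφR := integral_mul_indicator_right hX n hφm hφb
  have hψR := integral_mul_indicator_right hX n hψm hψb
  have i1 : Integrable (fun ω => φ ω * R ω) P := hRi.bdd_mul hφa (Eventually.of_forall hφb)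
  have i2 : Integrable (fun ω => ψ ω * R ω) P := hRi.bdd_mul hψa (Eventually.of_forall hψb)
  have i3 : Integrable (fun ω => φ ω * W ω) P := hWi.bdd_mul hφa (Eventually.of_forall hφb)
  have i4 : Integrable (fun ω => ψ ω * W ω) P := hWi.bdd_mul hψa (Eventually.of_forall hψb)
  calc _ = ∫ ω, (φ ω * W ω + (ψ ω - ψ ω * W ω)) ∂P := by
        refine integral_congr_ae (Eventually.of_forall fun ω => ?_)
        by_cases h0 : X n ω = 0
        · have : ¬ ∀ m < n + 1, X m ω ≠ 0 := fun h => h n (by omega) h0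
          simp only [hφ, hψ, if_neg this, h0, avoidWithin]
          rw [stoppedMean_of_notMem _ _ _ (by simp)]
          simp
        · have : (∀ m < n, X m ω ≠ 0) ↔ ∀ m < n + 1, X m ω ≠ 0 := by
            refine ⟨fun h m hm => ?_, fun h m hm => h m (by omega)⟩
            rcases (Nat.lt_succ_iff.1 hm).eq_or_lt with rfl | hm'
            · exact h0
            · exact h m hm'
          simp only [hφ, hψ, hW, this]
          split_ifs
          · rw [avoidWithin, stoppedMean_succ_of_mem _ _ _ (by simpa using h0), stepMean]
            ring
          · simp
    _ = ∫ ω, (φ ω * R ω + (ψ ω - ψ ω * R ω)) ∂P := by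
        have i5 : Integrable (fun ω => ψ ω - ψ ω * W ω) P := hψi.sub i4
        have i6 : Integrable (fun ω => ψ ω - ψ ω * R ω) P := hψi.sub i2
        rw [integral_add i3 i5, integral_add i1 i6, integral_sub hψi i4, integral_sub hψi i2,
          hφR, hψR]
    _ = _ := by
        refine integral_congr_ae ?_
        filter_upwards [hX.steps n] with ω hω
        rcases (abs_eq zero_le_one).1 hω with h | h
        · have h' : X (n + 1) ω = X n ω + 1 := by omega
          simp [hφ, hψ, hR, h', usedSites_succ_of_right h']
        · have h' : X (n + 1) ω = X n ω - 1 := by omega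
          have h'' : ¬ X (n + 1) ω = X n ω + 1 := by omega
          simp only [hφ, hψ, hR, Set.indicator, Set.mem_ofPred_eq, if_neg h'']
          simp [h', usedSites_succ_of_left h']

lemma measurableSet_avoid (hX : ∀ n, Measurable (X n)) (n : ℕ) :
    MeasurableSet {ω | ∀ m < n + 1, X m ω ≠ 0} := by
  have : {ω | ∀ m < n + 1, X m ω ≠ 0} = ⋂ m, ⋂ (_ : m < n + 1), {ω | X m ω = 0}ᶜ := by
    ext; simp
  rw [this]
  exact MeasurableSet.iInter fun m => MeasurableSet.iInter fun _ =>
    (hX m (measurableSet_singleton 0)).compl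

lemma measureReal_avoid_eq [IsProbabilityMeasure P] (hX : IsCookieRW P (fun _ => p) X)
    (hX0 : ∀ᵐ ω ∂P, X 0 ω = 1) (n : ℕ) :
    P.real {ω | ∀ m < n + 1, X m ω ≠ 0} = avoidWithin p n ∅ 1 := by
  classical
  have key : ∀ j ≤ n, ∫ ω, (if ∀ m < j, X m ω ≠ 0 then
      avoidWithin p (n - j) (usedSites X j ω) (X j ω) else 0) ∂P = avoidWithin p n ∅ 1 := by
    intro j
    induction j with
    | zero =>
      intro _
      calc _ = ∫ ω, avoidWithin p n ∅ 1 ∂P := by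
            refine integral_congr_ae ?_
            filter_upwards [hX0] with ω hω
            simp [hω, usedSites]
        _ = _ := by simp
    | succ j ih =>
      intro hj
      rw [← ih (by omega), show n - j = n - (j + 1) + 1 by omega]
      exact (integral_avoidWithin_step hX j _).symm
  have hset := measurableSet_avoid hX.meas n
  rw [← key n le_rfl, ← integral_indicator_one hset]
  refine integral_congr_ae (Eventually.of_forall fun ω => ?_)
  have e : avoidWithin p (n - n) (usedSites X n ω) (X n ω) = if X n ω = 0 then 0 else 1 := by
    rw [Nat.sub_self]; rfl
  simp only [e, Set.indicator, Set.mem_ofPred_eq, Nat.lt_succ_iff_lt_or_eq, or_imp, forall_and,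
    forall_eq]
  by_cases h1 : ∀ m < n, X m ω ≠ 0 <;> by_cases h2 : X n ω = 0 <;> simp [h2]

lemma measureReal_hitTime_eq_top [IsProbabilityMeasure P] (hp : p ∈ Set.Ioo (2 / 3 : ℝ) 1)
    (hX : IsCookieRW P (fun _ => p) X) (hX0 : ∀ᵐ ω ∂P, X 0 ω = 1) :
    P.real {ω | hitTime X 0 ω = ⊤} = (3 * p - 2) / (2 * p - 1) := by
  refine limit_avoidWithin hp ?_
  have hInter : {ω | hitTime X 0 ω = ⊤} = ⋂ n, {ω | ∀ m < n + 1, X m ω ≠ 0} := by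
    ext ω
    simp only [Set.mem_ofPred_eq, hitTime_eq_top_iff, Set.mem_iInter]
    exact ⟨fun h n m _ => h m, fun h n => h n n (by omega)⟩
  have hlim := tendsto_measure_iInter_atTop (μ := P) (fun n => (measurableSet_avoid hX.meas n).nullMeasurableSet)
    (fun i j hij ω h m hm => h m (by omega)) ⟨0, measure_ne_top P _⟩
  rw [← hInter] at hlim
  have := (ENNReal.tendsto_toReal (measure_ne_top P _)).comp hlim
  exact this.congr fun n => measureReal_avoid_eq hX hX0 n

end Walk

/-- For `p ∈ (2/3, 1)`, `P(T₀ = ∞) ≥ (3p-2)/(2p-1)`, with equality when `p ∈ [3/4, 1)`. -/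
theorem stmt13 (p : ℝ) (hp : p ∈ Set.Ioo (2 / 3 : ℝ) 1)
    {Ω : Type*} [MeasurableSpace Ω] (P : Measure Ω) [IsProbabilityMeasure P]
    (X : ℕ → Ω → ℤ) (hX : IsCookieRW P (fun _ => p) X) (hX0 : ∀ᵐ ω ∂P, X 0 ω = 1) :
    (3 * p - 2) / (2 * p - 1) ≤ (P {ω | hitTime X 0 ω = ⊤}).toReal ∧
    (3 / 4 ≤ p → (P {ω | hitTime X 0 ω = ⊤}).toReal = (3 * p - 2) / (2 * p - 1)) := by
  have h := measureReal_hitTime_eq_top hp hX hX0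
  exact ⟨h.ge, fun _ => h⟩
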